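/- Let k ≥ 3 and N ≥ 1 be integers and let G be a subgroup of SL(2,ℤ) with Γ(N) ⊆ G. Define E_k(G) := {f ∈ span_ℂ{E_k(·, λ̄, N) : λ̄ ∈ Λ_N} : f|_k γ = f for all γ ∈ G}. Then: (i) if k is even (so k ≥ 4), dim_ℂ E_k(G) equals the number of orbits in Λ_N of the right action of the subgroup of SL(2,ℤ) generated by G and −Id (this number equals the number of cusps of G); (ii) if k is odd and −Id ∉ G, then 2·dim_ℂ E_k(G) equals the number of G-orbits O ⊆ Λ_N with O ∩ (−O) = ∅ (twice the number of regular cusps of G); (iii) if k is odd and −Id ∈ G, then E_k(G) = {0}. -/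

import Mathlib

open scoped MatrixGroups
open Complex UpperHalfPlane

noncomputable section

abbrev SL2Z := Matrix.SpecialLinearGroup (Fin 2) ℤ

/-- weight `k` slash action of `γ ∈ SL(2,ℤ)` on functions `ℍ → ℂ`. -/
def slashf (k : ℤ) (γ : SL2Z) (f : ℍ → ℂ) : ℍ → ℂ :=
  fun τ => (((γ 1 0 : ℤ) : ℂ) * (τ : ℂ) + ((γ 1 1 : ℤ) : ℂ)) ^ (-k) * f (γ • τ)

/-- normalized Eisenstein series of weight `k` on `Γ(N)` -/
def Ek (k N : ℕ) (lam : ZMod N × ZMod N) : ℍ → ℂ :=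
  fun τ => (if 3 ≤ N then (1 : ℂ) else 1/2) * ∑' cd : ℤ × ℤ,
    if Int.gcd cd.1 cd.2 = 1 ∧ (cd.1 : ZMod N) = lam.1 ∧ (cd.2 : ZMod N) = lam.2
    then ((cd.1 : ℂ) * (τ : ℂ) + (cd.2 : ℂ)) ^ (-(k : ℤ)) else 0

/-- right action of `SL(2,ℤ)` on row vectors mod `N` -/
def rmul {N : ℕ} (lam : ZMod N × ZMod N) (γ : SL2Z) : ZMod N × ZMod N :=
  (lam.1 * ((γ 0 0 : ℤ) : ZMod N) + lam.2 * ((γ 1 0 : ℤ) : ZMod N),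
   lam.1 * ((γ 0 1 : ℤ) : ZMod N) + lam.2 * ((γ 1 1 : ℤ) : ZMod N))

/-- `-Id` in `SL(2,ℤ)` -/
def negId : SL2Z := ⟨!![-1, 0; 0, -1], by norm_num [Matrix.det_fin_two_of]⟩

/-- `O` is an orbit of the right `G`-action on `Λ_N` -/
def isOrbit (N : ℕ) (G : Subgroup SL2Z) (O : Set (ZMod N × ZMod N)) : Prop :=
  ∃ lam : ZMod N × ZMod N, addOrderOf lam = N ∧ O = {μ | ∃ γ ∈ G, rmul lam γ = μ}

/-- the submodule of functions invariant under the weight-`k` slash action of `G`. -/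
def invariants (k : ℤ) (G : Subgroup SL2Z) : Submodule ℂ (ℍ → ℂ) where
  carrier := {f | ∀ γ ∈ G, slashf k γ f = f}
  add_mem' := by
    intro f g hf hg γ hγ
    funext τ
    have h1 := congrFun (hf γ hγ) τ
    have h2 := congrFun (hg γ hγ) τ
    simp only [slashf, Pi.add_apply] at h1 h2 ⊢
    rw [mul_add, h1, h2]
  zero_mem' := by
    intro γ hγ
    funext τ
    simp [slashf]
  smul_mem' := by
    intro c f hf γ hγ
    funext τ
    have h1 := congrFun (hf γ hγ) τ
    simp only [slashf, Pi.smul_apply, smul_eq_mul] at h1 ⊢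
    rw [← h1]; ring

/-- the space `E_k(G)` of `G`-invariant weight-`k` Eisenstein series of level `N`. -/
def EisSpace (k N : ℕ) (G : Subgroup SL2Z) : Submodule ℂ (ℍ → ℂ) :=
  (Submodule.span ℂ
    {g : ℍ → ℂ | ∃ lam : ZMod N × ZMod N, addOrderOf lam = N ∧ g = Ek k N lam}) ⊓
  invariants (k : ℤ) G

lemma rmul_rmul {N : ℕ} (lam : ZMod N × ZMod N) (γ δ : SL2Z) :
    rmul (rmul lam γ) δ = rmul lam (γ * δ) := by
  ext <;> simp [rmul, Matrix.mul_apply, Fin.sum_univ_two] <;> ring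

lemma rmul_one {N : ℕ} (lam : ZMod N × ZMod N) : rmul lam 1 = lam := by
  ext <;> simp [rmul]

lemma rmul_negId {N : ℕ} (lam : ZMod N × ZMod N) : rmul lam negId = -lam := by
  ext <;> simp [rmul, negId]

lemma rmul_neg {N : ℕ} (lam : ZMod N × ZMod N) (γ : SL2Z) : rmul (-lam) γ = -rmul lam γ := by
  ext <;> simp [rmul] <;> ring

lemma rmul_injective {N : ℕ} (γ : SL2Z) :
    Function.Injective fun lam : ZMod N × ZMod N => rmul lam γ :=
  Function.LeftInverse.injective (g := fun x => rmul x γ⁻¹) fun x => by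
    change rmul (rmul x γ) γ⁻¹ = x
    rw [rmul_rmul, mul_inv_cancel, rmul_one]

lemma addOrderOf_rmul {N : ℕ} (lam : ZMod N × ZMod N) (γ : SL2Z) :
    addOrderOf (rmul lam γ) = addOrderOf lam := by
  let φ : ZMod N × ZMod N →+ ZMod N × ZMod N :=
    { toFun := fun x => rmul x γ
      map_zero' := by ext <;> simp [rmul]
      map_add' := fun x y => by ext <;> simp [rmul] <;> ring }
  exact addOrderOf_injective φ (rmul_injective γ) lam

/-- Any `a ≠ 0` and `b` with `gcd(a, b, N) = 1` become coprime after translating `b` by a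
multiple of `N`. -/
lemma exists_coprime_add_mul {a b N : ℕ} (ha : a ≠ 0) (hN : N ≠ 0)
    (h : Nat.gcd a (Nat.gcd b N) = 1) : ∃ c : ℕ, Nat.Coprime a c ∧ (c : ZMod N) = b := by
  set g := Nat.gcd b N with hg
  have hg0 : 0 < g := Nat.gcd_pos_of_pos_right _ (Nat.pos_of_ne_zero hN)
  obtain ⟨b', hb'⟩ : g ∣ b := Nat.gcd_dvd_left _ _
  obtain ⟨N', hN'⟩ : g ∣ N := Nat.gcd_dvd_right _ _
  have hcop : Nat.Coprime b' N' := by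
    have := Nat.coprime_div_gcd_div_gcd (m := b) (n := N) hg0
    rw [← hg] at this
    rwa [Nat.div_eq_of_eq_mul_right hg0 hb', Nat.div_eq_of_eq_mul_right hg0 hN'] at this
  have hN'0 : N' ≠ 0 := by rintro rfl; simp at hN'; exact hN hN'
  have : NeZero (N' * a) := ⟨mul_ne_zero hN'0 ha⟩
  obtain ⟨u, hu⟩ := ZMod.unitsMap_surjective (Dvd.intro a rfl : N' ∣ N' * a)
    (ZMod.unitOfCoprime b' hcop)
  have hcast : ((u : ZMod (N' * a)).val : ZMod N') = (b' : ZMod N') := by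
    have := congrArg Units.val hu
    rw [ZMod.unitsMap_val, ZMod.coe_unitOfCoprime] at this
    rw [← this, ZMod.natCast_val]
  refine ⟨g * (u : ZMod (N' * a)).val, ?_, ?_⟩
  · refine Nat.Coprime.mul_right h ?_
    exact (Nat.Coprime.coprime_mul_left_right (ZMod.val_coe_unit_coprime u)).symm
  · rw [ZMod.natCast_eq_natCast_iff] at hcast ⊢
    have := hcast.mul_left' g
    rwa [← hN', ← hb'] at this

lemma gcd_val_eq_one {N : ℕ} [NeZero N] {lam : ZMod N × ZMod N} (h : addOrderOf lam = N)
    {a : ℕ} (ha : (a : ZMod N) = lam.1) : Nat.gcd a (Nat.gcd lam.2.val N) = 1 := by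
  set g := Nat.gcd a (Nat.gcd lam.2.val N) with hg
  have hga : g ∣ a := Nat.gcd_dvd_left _ _
  have hgb : g ∣ lam.2.val := (Nat.gcd_dvd_right _ _).trans (Nat.gcd_dvd_left _ _)
  have hgN : g ∣ N := (Nat.gcd_dvd_right _ _).trans (Nat.gcd_dvd_right _ _)
  obtain ⟨M, hM⟩ := hgN
  have hN : N ≠ 0 := NeZero.ne N
  have key : ∀ x : ℕ, g ∣ x → (M : ZMod N) * (x : ZMod N) = 0 := by
    rintro x ⟨y, rfl⟩
    rw [← Nat.cast_mul, ZMod.natCast_eq_zero_iff]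
    exact ⟨y, by rw [hM]; ring⟩
  have hz : M • lam = 0 := by
    ext
    · simpa [ha] using key a hga
    · simpa using key _ hgb
  have hdvd := addOrderOf_dvd_of_nsmul_eq_zero hz
  rw [h] at hdvd
  have hM0 : 0 < M := Nat.pos_of_ne_zero (by rintro rfl; simp at hM; exact hN hM)
  have hle := Nat.le_of_dvd hM0 hdvd
  have hg0 : g ≠ 0 := by rintro h0; rw [h0] at hM; simp at hM; exact hN hM
  by_contra hne
  have : 2 ≤ g := by omega
  nlinarith

/-- `SL(2,ℤ)` acts transitively on row vectors of additive order `N`. -/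
lemma exists_rmul_eq {N : ℕ} [NeZero N] {lam : ZMod N × ZMod N} (h : addOrderOf lam = N) :
    ∃ γ : SL2Z, rmul (0, 1) γ = lam := by
  obtain ⟨c, hc, hcb⟩ := exists_coprime_add_mul (a := lam.1.val + N) (b := lam.2.val)
    (by have := NeZero.ne N; omega) (NeZero.ne N) (gcd_val_eq_one h (by simp))
  obtain ⟨γ, -, hγ⟩ := ModularGroup.bottom_row_surj (R := ℤ)
    (show ![((lam.1.val + N : ℕ) : ℤ), (c : ℤ)] ∈ {cd | IsCoprime (cd 0) (cd 1)} by
      simpa using Nat.isCoprime_iff_coprime.mpr hc)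
  have h0 : γ 1 0 = ((lam.1.val + N : ℕ) : ℤ) := congrFun hγ 0
  have h1 : γ 1 1 = (c : ℤ) := congrFun hγ 1
  refine ⟨γ, ?_⟩
  ext
  · simp [rmul, h0]
  · simp [rmul, h1, hcb]

lemma denom_SL2Z (γ : SL2Z) (τ : ℍ) : UpperHalfPlane.denom γ τ =
    ((γ 1 0 : ℤ) : ℂ) * (τ : ℂ) + ((γ 1 1 : ℤ) : ℂ) := by
  simp [UpperHalfPlane.denom]

lemma bottom_row_smul_ne_zero (γ : SL2Z) (τ : ℍ) :
    ((γ 1 0 : ℤ) : ℂ) * (τ : ℂ) + ((γ 1 1 : ℤ) : ℂ) ≠ 0 := by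
  rw [← denom_SL2Z]
  exact UpperHalfPlane.denom_ne_zero γ τ

/-- Right multiplication of integral row vectors by `γ`. -/
def intRowEquiv (γ : SL2Z) : ℤ × ℤ ≃ ℤ × ℤ where
  toFun v := (v.1 * γ 0 0 + v.2 * γ 1 0, v.1 * γ 0 1 + v.2 * γ 1 1)
  invFun v := (v.1 * γ 1 1 - v.2 * γ 1 0, - v.1 * γ 0 1 + v.2 * γ 0 0)
  left_inv v := by
    have h := γ.det_coe
    rw [Matrix.det_fin_two] at h
    ext
    · linear_combination v.1 * h
    · linear_combination v.2 * h
  right_inv v := by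
    have h := γ.det_coe
    rw [Matrix.det_fin_two] at h
    ext
    · linear_combination v.1 * h
    · linear_combination v.2 * h

lemma gcd_intRowEquiv (γ : SL2Z) (v : ℤ × ℤ) :
    Int.gcd (intRowEquiv γ v).1 (intRowEquiv γ v).2 = 1 ↔ Int.gcd v.1 v.2 = 1 := by
  have key : ∀ (δ : SL2Z) (w : ℤ × ℤ), IsCoprime w.1 w.2 →
      IsCoprime (intRowEquiv δ w).1 (intRowEquiv δ w).2 := by
    intro δ w hw
    have := IsCoprime.vecMulSL (v := ![w.1, w.2]) (by simpa using hw) δ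
    simpa [Matrix.vecMul, dotProduct, Fin.sum_univ_two, intRowEquiv] using this
  have hinv : intRowEquiv γ⁻¹ (intRowEquiv γ v) = v := by
    have : ∀ w, intRowEquiv γ⁻¹ w = (intRowEquiv γ).symm w := by
      intro w
      simp [intRowEquiv, Matrix.adjugate_fin_two, sub_eq_add_neg]
    rw [this, Equiv.symm_apply_apply]
  rw [← Int.isCoprime_iff_gcd_eq_one, ← Int.isCoprime_iff_gcd_eq_one]
  refine ⟨fun h => ?_, key γ v⟩
  have := key γ⁻¹ _ h
  rwa [hinv] at this

lemma intRowEquiv_congr {N : ℕ} (γ : SL2Z) (v : ℤ × ℤ) (lam : ZMod N × ZMod N) :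
    (((intRowEquiv γ v).1 : ZMod N) = (rmul lam γ).1 ∧
      ((intRowEquiv γ v).2 : ZMod N) = (rmul lam γ).2) ↔
      ((v.1 : ZMod N) = lam.1 ∧ (v.2 : ZMod N) = lam.2) := by
  have : (((intRowEquiv γ v).1 : ZMod N), ((intRowEquiv γ v).2 : ZMod N)) =
      rmul ((v.1 : ZMod N), (v.2 : ZMod N)) γ := by
    ext <;> simp [intRowEquiv, rmul]
  rw [← Prod.mk_inj, ← Prod.mk_inj, this]
  exact (rmul_injective γ).eq_iff

/-- The slash action permutes the Eisenstein series of level `N`. -/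
lemma slashf_Ek (k N : ℕ) (γ : SL2Z) (lam : ZMod N × ZMod N) :
    slashf k γ (Ek k N lam) = Ek k N (rmul lam γ) := by
  funext τ
  simp only [slashf, Ek]
  rw [mul_left_comm, ← tsum_mul_left]
  conv_rhs => rw [← (intRowEquiv γ).tsum_eq]
  congr 1
  refine tsum_congr fun v => ?_
  have hiff : (Int.gcd (intRowEquiv γ v).1 (intRowEquiv γ v).2 = 1 ∧
      ((intRowEquiv γ v).1 : ZMod N) = (rmul lam γ).1 ∧
      ((intRowEquiv γ v).2 : ZMod N) = (rmul lam γ).2) ↔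
      (Int.gcd v.1 v.2 = 1 ∧ (v.1 : ZMod N) = lam.1 ∧ (v.2 : ZMod N) = lam.2) := by
    rw [gcd_intRowEquiv, intRowEquiv_congr]
  by_cases h : Int.gcd v.1 v.2 = 1 ∧ (v.1 : ZMod N) = lam.1 ∧ (v.2 : ZMod N) = lam.2
  · rw [if_pos h, if_pos (hiff.mpr h)]
    have h1 := EisensteinSeries.eisSummand_SL2_apply k ![v.1, v.2] γ τ
    simp only [EisensteinSeries.eisSummand, denom_SL2Z, Matrix.vecMul, dotProduct,
      Fin.sum_univ_two, Matrix.cons_val_zero, Matrix.cons_val_one] at h1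
    rw [h1, ← mul_assoc, zpow_neg, inv_mul_cancel₀ (zpow_ne_zero _ (bottom_row_smul_ne_zero γ τ)),
      one_mul]
    simp [intRowEquiv]
  · rw [if_neg h, if_neg (fun h' => h (hiff.mp h')), mul_zero]

lemma slashf_negId (k : ℕ) (f : ℍ → ℂ) : slashf k negId f = (-1 : ℂ) ^ k • f := by
  funext τ
  have h : negId • τ = τ := by
    have : negId = -1 := by
      ext i j
      fin_cases i <;> fin_cases j <;> simp [negId]
    rw [this, ModularGroup.SL_neg_smul, one_smul]
  simp only [slashf, h, Pi.smul_apply, smul_eq_mul]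
  congr 1
  rcases Nat.even_or_odd k with hk | hk <;> simp [negId, hk.neg_one_pow]

lemma Ek_neg (k N : ℕ) (lam : ZMod N × ZMod N) :
    Ek k N (-lam) = (-1 : ℂ) ^ k • Ek k N lam := by
  rw [← slashf_negId, slashf_Ek, rmul_negId]

open Filter Topology in
/-- The value of `E_k(·, λ)` at the cusp `∞`. -/
lemma tendsto_Ek {k : ℕ} (N : ℕ) (hk : 3 ≤ k) (lam : ZMod N × ZMod N) :
    Tendsto (fun n : ℕ => Ek k N lam ⟨⟨0, n + 1⟩, by simp; positivity⟩) atTop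
      (𝓝 ((if 3 ≤ N then (1 : ℂ) else 1/2) *
        ((if lam = (0, 1) then 1 else 0) + (-1) ^ k * (if lam = -(0, 1) then 1 else 0)))) := by
  have hk' : (2 : ℝ) < k := by exact_mod_cast hk
  refine Tendsto.const_mul _ ?_
  let g : ℤ × ℤ → ℂ := fun cd =>
    if Int.gcd cd.1 cd.2 = 1 ∧ (cd.1 : ZMod N) = lam.1 ∧ (cd.2 : ZMod N) = lam.2
    then (if cd.1 = 0 then (cd.2 : ℂ) ^ (-(k : ℤ)) else 0) else 0
  have hg : ∑' cd, g cd =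
      (if lam = (0, 1) then 1 else 0) + (-1) ^ k * (if lam = -(0, 1) then 1 else 0) := by
    rw [tsum_eq_sum (s := {((0 : ℤ), (1 : ℤ)), (0, -1)})]
    · rw [Finset.sum_pair (by decide)]
      congr 1
      · simp only [g]
        have : ((((0 : ℤ) : ZMod N) = lam.1 ∧ ((1 : ℤ) : ZMod N) = lam.2)) ↔ lam = (0, 1) := by
          rw [Prod.ext_iff]; simp [eq_comm]
        simp only [this]
        simp
      · simp only [g]
        have : ((((0 : ℤ) : ZMod N) = lam.1 ∧ ((-1 : ℤ) : ZMod N) = lam.2)) ↔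
            lam = -(0, 1) := by
          rw [Prod.ext_iff]; simp [eq_comm]
        simp only [this]
        rcases Nat.even_or_odd k with h | h <;> simp [h.neg_one_pow]
    · rintro ⟨c, d⟩ hcd
      simp only [g]
      split_ifs with h1 h2
      · exfalso
        subst h2
        have h3 : d.natAbs = 1 := by simpa using h1.1
        rcases Int.natAbs_eq d with h | h <;> rw [h3] at h <;> simp [h] at hcd
      · rfl
      · rfl
  rw [← hg]
  have hsum : Summable fun cd : ℤ × ℤ =>
      EisensteinSeries.r ⟨⟨0, 1⟩, zero_lt_one⟩ ^ (-(k : ℝ)) * ‖![cd.1, cd.2]‖ ^ (-(k : ℝ)) := by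
    refine Summable.mul_left _ ?_
    exact (finTwoArrowEquiv ℤ).symm.summable_iff.mpr
      (EisensteinSeries.summable_one_div_norm_rpow hk')
  refine tendsto_tsum_of_dominated_convergence hsum (fun cd => ?_)
    (Eventually.of_forall fun n cd => ?_)
  · simp only [g]
    split_ifs with h1 h2
    · simp [h2]
    · refine squeeze_zero_norm (fun n => ?_) tendsto_one_div_add_atTop_nhds_zero_nat
      have hc : (1 : ℝ) ≤ |(cd.1 : ℝ)| := by exact_mod_cast Int.one_le_abs h2
      have hn : (n : ℝ) + 1 ≤ ‖(cd.1 : ℂ) * (⟨0, n + 1⟩ : ℂ) + (cd.2 : ℂ)‖ := by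
        refine le_trans ?_ (Complex.abs_im_le_norm _)
        simp only [Complex.add_im, Complex.mul_im, Complex.intCast_re, Complex.intCast_im,
          mul_zero, add_zero, abs_mul]
        rw [abs_of_nonneg (by positivity : (0 : ℝ) ≤ n + 1)]
        nlinarith
      rw [norm_zpow, zpow_neg, zpow_natCast, one_div]
      refine inv_anti₀ (by positivity) (hn.trans (le_self_pow₀ ?_ (by omega)))
      exact le_trans (by simp) hn
    · exact tendsto_const_nhds
  · have hmem : (⟨⟨0, n + 1⟩, by simp; positivity⟩ : ℍ) ∈ verticalStrip 0 1 := by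
      simp [UpperHalfPlane.mem_verticalStrip_iff, UpperHalfPlane.re, UpperHalfPlane.im]
    have hb := EisensteinSeries.summand_bound_of_mem_verticalStrip (k := (k : ℝ))
      (Nat.cast_nonneg k) ![cd.1, cd.2] zero_lt_one hmem
    split_ifs
    · rw [norm_zpow]
      rw [← Real.rpow_intCast]
      push_cast
      simpa using hb
    · rw [norm_zero]
      have := EisensteinSeries.r_pos ⟨⟨0, 1⟩, zero_lt_one⟩
      positivity

lemma card_ne_eq_two_mul {Ω : Type*} [Fintype Ω] [LinearOrder Ω] {σ : Ω → Ω}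
    (hσ : Function.Involutive σ) :
    Fintype.card {x // σ x ≠ x} = 2 * Fintype.card {x // x < σ x} := by
  have h1 : (Finset.univ.filter fun x => σ x < x).card =
      (Finset.univ.filter fun x => x < σ x).card :=
    Finset.card_nbij' σ σ (by simp [Set.MapsTo, hσ _]) (by simp [Set.MapsTo, hσ _])
      (fun x _ => hσ x) (fun x _ => hσ x)
  have h2 : (Finset.univ.filter fun x => σ x ≠ x) =
      (Finset.univ.filter fun x => σ x < x) ∪ (Finset.univ.filter fun x => x < σ x) := by
    ext x
    simp [lt_or_lt_iff_ne]
  rw [Fintype.card_subtype, Fintype.card_subtype, h2, Finset.card_union_of_disjoint, h1, two_mul]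
  exact Finset.disjoint_filter.mpr fun x _ => lt_asymm

/-- The space of functions which are odd for an involution `σ` has dimension half the number of
points not fixed by `σ`. -/
lemma two_mul_finrank_odd {Ω : Type*} [Finite Ω] {σ : Ω → Ω} (hσ : Function.Involutive σ)
    (W : Submodule ℂ (Ω → ℂ)) (hW : ∀ g, g ∈ W ↔ ∀ x, g (σ x) = -g x) :
    2 * Module.finrank ℂ W = Nat.card {x // σ x ≠ x} := by
  classical
  have := Fintype.ofFinite Ω
  let _ : LinearOrder Ω := LinearOrder.lift' (Fintype.equivFin Ω) (Fintype.equivFin Ω).injective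
  let φ : W →ₗ[ℂ] ({x // x < σ x} → ℂ) :=
    LinearMap.funLeft ℂ ℂ Subtype.val ∘ₗ W.subtype
  have hφ : Function.Bijective φ := by
    constructor
    · rw [injective_iff_map_eq_zero]
      rintro ⟨g, hg⟩ h
      rw [hW] at hg
      have h0 : ∀ x, x < σ x → g x = 0 := fun x hx => congrFun h ⟨x, hx⟩
      refine Subtype.ext (funext fun x => ?_)
      change g x = 0
      rcases lt_trichotomy x (σ x) with hx | hx | hx
      · exact h0 x hx
      · have := hg x
        rw [← hx] at this
        exact self_eq_neg.mp this
      · have := h0 (σ x) (by rwa [hσ])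
        rwa [hg, neg_eq_zero] at this
    · intro f
      let g : Ω → ℂ := fun x => if h : x < σ x then f ⟨x, h⟩ else
        if h : σ x < σ (σ x) then -f ⟨σ x, h⟩ else 0
      refine ⟨⟨g, (hW g).mpr fun x => ?_⟩, funext fun x => dif_pos x.2⟩
      rcases lt_trichotomy x (σ x) with hx | hx | hx
      · simp [g, hσ x, hx, hx.not_gt]
      · simp [g, ← hx]
      · simp [g, hσ x, hx, hx.not_gt]
  rw [(LinearEquiv.ofBijective φ hφ).finrank_eq, Module.finrank_pi, Nat.card_eq_fintype_card,
    card_ne_eq_two_mul hσ]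

lemma neg_one_pow_mul_self (k : ℕ) : (-1 : ℂ) ^ k * (-1) ^ k = 1 := by
  rw [← mul_pow]; simp

/-- The set `Λ_N` of row vectors of additive order `N`. -/
abbrev Lam (N : ℕ) := {lam : ZMod N × ZMod N // addOrderOf lam = N}

/-- The permutation of `Λ_N` induced by `γ`. -/
def Lam.act {N : ℕ} (γ : SL2Z) : Lam N ≃ Lam N where
  toFun l := ⟨rmul l.1 γ, by rw [addOrderOf_rmul, l.2]⟩
  invFun l := ⟨rmul l.1 γ⁻¹, by rw [addOrderOf_rmul, l.2]⟩
  left_inv l := Subtype.ext (by simp [rmul_rmul, rmul_one])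
  right_inv l := Subtype.ext (by simp [rmul_rmul, rmul_one])

lemma Lam.act_act {N : ℕ} (γ δ : SL2Z) (l : Lam N) : act δ (act γ l) = act (γ * δ) l :=
  Subtype.ext (rmul_rmul _ _ _)

lemma Lam.act_one {N : ℕ} (l : Lam N) : act 1 l = l := Subtype.ext (rmul_one _)

lemma Lam.coe_act_negId {N : ℕ} (l : Lam N) : (act negId l).1 = -l.1 := rmul_negId _

lemma Lam.act_negId_act_negId {N : ℕ} (l : Lam N) : act negId (act negId l) = l :=
  Subtype.ext (by simp [coe_act_negId])

lemma Lam.act_negId_comm {N : ℕ} (γ : SL2Z) (l : Lam N) :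
    act γ (act negId l) = act negId (act γ l) :=
  Subtype.ext (by rw [coe_act_negId]; change rmul (act negId l).1 γ = _
                  rw [coe_act_negId, rmul_neg]; rfl)

section Dimension

variable {k N : ℕ} {G : Subgroup SL2Z}

/-- The orbit of an element of `Λ_N`. -/
def orbitOf (G : Subgroup SL2Z) (l : Lam N) : {O : Set (ZMod N × ZMod N) // isOrbit N G O} :=
  ⟨{μ | ∃ γ ∈ G, rmul l.1 γ = μ}, l.1, l.2, rfl⟩

lemma orbitOf_surjective : Function.Surjective (orbitOf G : Lam N → _) := by
  rintro ⟨_, lam, hlam, rfl⟩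
  exact ⟨⟨lam, hlam⟩, rfl⟩

lemma orbitOf_eq_iff {l m : Lam N} : orbitOf G l = orbitOf G m ↔ ∃ γ ∈ G, Lam.act γ l = m := by
  constructor
  · intro h
    have hm : m.1 ∈ (orbitOf G m).1 := ⟨1, one_mem _, rmul_one _⟩
    rw [← h] at hm
    obtain ⟨γ, hγ, h'⟩ := hm
    exact ⟨γ, hγ, Subtype.ext h'⟩
  · rintro ⟨γ, hγ, rfl⟩
    refine Subtype.ext (Set.ext fun μ => ⟨?_, ?_⟩)
    · rintro ⟨δ, hδ, rfl⟩
      refine ⟨γ⁻¹ * δ, mul_mem (inv_mem hγ) hδ, ?_⟩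
      change rmul (rmul l.1 γ) _ = _
      rw [rmul_rmul, mul_inv_cancel_left]
    · rintro ⟨δ, hδ, rfl⟩
      exact ⟨γ * δ, mul_mem hγ hδ, (rmul_rmul _ _ _).symm⟩

/-- The elements of `SL(2,ℤ)` which preserve a function on `Λ_N`. -/
def coeffStabilizer (c : Lam N → ℂ) : Subgroup SL2Z where
  carrier := {γ | ∀ l, c (Lam.act γ l) = c l}
  mul_mem' hγ hδ l := by rw [← Lam.act_act, hδ, hγ]
  one_mem' l := by rw [Lam.act_one]
  inv_mem' {γ} hγ l := by rw [← hγ, Lam.act_act, inv_mul_cancel, Lam.act_one]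

lemma exists_comp_orbitOf {c : Lam N → ℂ} (hc : G ≤ coeffStabilizer c) :
    ∃ g : {O : Set (ZMod N × ZMod N) // isOrbit N G O} → ℂ, ∀ l, g (orbitOf G l) = c l := by
  refine ⟨fun O => c (Function.surjInv orbitOf_surjective O), fun l => ?_⟩
  obtain ⟨γ, hγ, h⟩ := orbitOf_eq_iff.mp
    (Function.surjInv_eq (orbitOf_surjective (G := G)) (orbitOf G l))
  exact (hc hγ _).symm.trans (congrArg c h)

/-- The orbit `-O`. -/
def negOrbit (O : {O : Set (ZMod N × ZMod N) // isOrbit N G O}) :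
    {O : Set (ZMod N × ZMod N) // isOrbit N G O} :=
  ⟨(fun μ => -μ) '' O.1, by
    obtain ⟨_, lam, hlam, rfl⟩ := O
    refine ⟨-lam, by rwa [addOrderOf_neg], Set.ext fun μ => ⟨?_, ?_⟩⟩
    · rintro ⟨_, ⟨γ, hγ, rfl⟩, rfl⟩
      exact ⟨γ, hγ, rmul_neg _ _⟩
    · rintro ⟨γ, hγ, rfl⟩
      exact ⟨_, ⟨γ, hγ, rfl⟩, (rmul_neg _ _).symm⟩⟩

lemma negOrbit_involutive : Function.Involutive (negOrbit : _ → {O // isOrbit N G O}) :=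
  fun O => Subtype.ext (by simp [negOrbit])

lemma orbitOf_act_negId (l : Lam N) : orbitOf G (Lam.act negId l) = negOrbit (orbitOf G l) := by
  refine Subtype.ext (Set.ext fun μ => ⟨?_, ?_⟩)
  · rintro ⟨γ, hγ, rfl⟩
    exact ⟨_, ⟨γ, hγ, rfl⟩, by rw [Lam.coe_act_negId, rmul_neg]⟩
  · rintro ⟨_, ⟨γ, hγ, rfl⟩, rfl⟩
    exact ⟨γ, hγ, by rw [Lam.coe_act_negId, rmul_neg]⟩

lemma negOrbit_ne_iff (O : {O : Set (ZMod N × ZMod N) // isOrbit N G O}) :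
    negOrbit O ≠ O ↔ O.1 ∩ ((fun μ => -μ) '' O.1) = ∅ := by
  obtain ⟨l, rfl⟩ := orbitOf_surjective O
  rw [← not_iff_not, not_not, ← ne_eq, ← Set.nonempty_iff_ne_empty]
  constructor
  · intro h
    have h' : (fun μ => -μ) '' (orbitOf G l).1 = (orbitOf G l).1 := congrArg Subtype.val h
    rw [h', Set.inter_self]
    exact ⟨l.1, 1, one_mem _, rmul_one _⟩
  · rintro ⟨_, ⟨γ, hγ, rfl⟩, _, ⟨δ, hδ, rfl⟩, h⟩
    rw [← orbitOf_act_negId, eq_comm, orbitOf_eq_iff]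
    refine ⟨γ * δ⁻¹, mul_mem hγ (inv_mem hδ), Subtype.ext ?_⟩
    change -rmul l.1 δ = rmul l.1 γ at h
    change rmul l.1 (γ * δ⁻¹) = _
    rw [← rmul_rmul, ← h, rmul_neg, rmul_rmul, mul_inv_cancel, rmul_one, Lam.coe_act_negId]

/-- Coefficient functions on `Λ_N` which are invariant under `G` and of parity `(-1) ^ k`. -/
def coeffSpace (k N : ℕ) (G : Subgroup SL2Z) : Submodule ℂ (Lam N → ℂ) where
  carrier := {c | (∀ γ ∈ G, ∀ l, c (Lam.act γ l) = c l) ∧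
    ∀ l, c (Lam.act negId l) = (-1) ^ k * c l}
  add_mem' hc hd := ⟨fun γ hγ l => by simp [hc.1 γ hγ l, hd.1 γ hγ l],
    fun l => by simp [hc.2 l, hd.2 l, mul_add]⟩
  zero_mem' := by simp
  smul_mem' a c hc := ⟨fun γ hγ l => by simp [hc.1 γ hγ l],
    fun l => by simp [hc.2 l, mul_left_comm]⟩

lemma coeffSpace_eq_bot_of_odd (hk : Odd k) (hG : negId ∈ G) : coeffSpace k N G = ⊥ := by
  refine (Submodule.eq_bot_iff _).mpr fun c hc => funext fun l => ?_
  have := hc.2 l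
  rw [hc.1 _ hG, hk.neg_one_pow, neg_one_mul] at this
  exact self_eq_neg.mp this

variable [NeZero N]

/-- The linear combination of Eisenstein series with given coefficients. -/
def eisSum (k N : ℕ) [NeZero N] : (Lam N → ℂ) →ₗ[ℂ] (ℍ → ℂ) :=
  Fintype.linearCombination ℂ fun l : Lam N => Ek k N l.1

lemma eisSum_apply (c : Lam N → ℂ) : eisSum k N c = ∑ l, c l • Ek k N l.1 := rfl

lemma range_eisSum : LinearMap.range (eisSum k N) = Submodule.span ℂ
    {g : ℍ → ℂ | ∃ lam : ZMod N × ZMod N, addOrderOf lam = N ∧ g = Ek k N lam} := by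
  rw [eisSum, Fintype.range_linearCombination]
  congr 1
  ext g
  simp [eq_comm]

lemma slashf_eisSum' (γ : SL2Z) (c : Lam N → ℂ) :
    slashf k γ (eisSum k N c) = ∑ l, c l • Ek k N (rmul l.1 γ) := by
  simp_rw [← slashf_Ek, eisSum_apply]
  funext τ
  simp only [slashf, Finset.sum_apply, Pi.smul_apply, smul_eq_mul, Finset.mul_sum]
  exact Finset.sum_congr rfl fun l _ => mul_left_comm _ _ _

lemma slashf_eisSum (γ : SL2Z) (c : Lam N → ℂ) :
    slashf k γ (eisSum k N c) = eisSum k N (fun l => c (Lam.act γ⁻¹ l)) := by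
  rw [slashf_eisSum', eisSum_apply,
    ← (Lam.act γ).sum_comp fun l => c (Lam.act γ⁻¹ l) • Ek k N l.1]
  refine Finset.sum_congr rfl fun l _ => ?_
  rw [Lam.act_act, mul_inv_cancel, Lam.act_one]
  rfl

lemma eisSum_comp_neg (c : Lam N → ℂ) :
    eisSum k N (fun l => c (Lam.act negId l)) = (-1 : ℂ) ^ k • eisSum k N c := by
  rw [eisSum_apply, eisSum_apply, ← (Lam.act negId).sum_comp, Finset.smul_sum]
  refine Finset.sum_congr rfl fun l _ => ?_
  rw [Lam.act_negId_act_negId, Lam.coe_act_negId, Ek_neg, smul_comm]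

/-- The relations between the Eisenstein series `E_k(·, λ)` are generated by
`E_k(·, -λ) = (-1) ^ k E_k(·, λ)`. -/
lemma coeff_add_eq_zero_of_eisSum_eq_zero (hk : 3 ≤ k) {c : Lam N → ℂ} (h : eisSum k N c = 0)
    (l : Lam N) : c l + (-1) ^ k * c (Lam.act negId l) = 0 := by
  obtain ⟨γ, hγ⟩ := exists_rmul_eq l.2
  have h0 : ∑ m : Lam N, c m • Ek k N (rmul m.1 γ⁻¹) = 0 := by
    rw [← slashf_eisSum', h]
    funext τ
    simp [slashf]
  have h1 := tendsto_finsetSum Finset.univ fun (m : Lam N) _ =>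
    (tendsto_Ek N hk (rmul m.1 γ⁻¹)).const_mul (c m)
  have h2 : ∀ m : Lam N, rmul m.1 γ⁻¹ = (0, 1) ↔ m = l := by
    intro m
    rw [← (rmul_injective γ).eq_iff, rmul_rmul, inv_mul_cancel, rmul_one, hγ, Subtype.ext_iff]
  have h3 : ∀ m : Lam N, rmul m.1 γ⁻¹ = -(0, 1) ↔ m = Lam.act negId l := by
    intro m
    rw [← (rmul_injective γ).eq_iff, rmul_rmul, inv_mul_cancel, rmul_one, rmul_neg, hγ,
      Subtype.ext_iff, Lam.coe_act_negId]
  have h4 : ∀ τ : ℍ, ∑ m : Lam N, c m * Ek k N (rmul m.1 γ⁻¹) τ = 0 := by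
    intro τ
    simpa using congrFun h0 τ
  simp only [h2, h3, h4] at h1
  have h5 := tendsto_nhds_unique h1 tendsto_const_nhds
  have h6 : (if 3 ≤ N then (1 : ℂ) else 1 / 2) ≠ 0 := by split_ifs <;> norm_num
  generalize (if 3 ≤ N then (1 : ℂ) else 1 / 2) = e at h5 h6
  simp only [mul_add, Finset.sum_add_distrib, mul_ite, mul_one, mul_zero, Finset.sum_ite_eq',
    Finset.mem_univ, if_true] at h5
  refine (mul_eq_zero_iff_left h6).mp ?_
  linear_combination h5

lemma eq_zero_of_eisSum_eq_zero (hk : 3 ≤ k) {c : Lam N → ℂ}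
    (hc : ∀ l, c (Lam.act negId l) = (-1) ^ k * c l) (h : eisSum k N c = 0) : c = 0 := by
  funext l
  have := coeff_add_eq_zero_of_eisSum_eq_zero hk h l
  rw [hc, ← mul_assoc, neg_one_pow_mul_self, one_mul] at this
  exact self_eq_neg.mp (eq_neg_of_add_eq_zero_left this)

lemma map_eisSum_coeffSpace (hk : 3 ≤ k) :
    (coeffSpace k N G).map (eisSum k N) = EisSpace k N G := by
  apply le_antisymm
  · rintro _ ⟨c, hc, rfl⟩
    refine ⟨range_eisSum (k := k) (N := N) ▸ LinearMap.mem_range_self _ c, fun γ hγ => ?_⟩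
    rw [slashf_eisSum]
    congr 1
    funext l
    exact hc.1 _ (inv_mem hγ) l
  · rintro f ⟨hf, hinv⟩
    rw [SetLike.mem_coe, ← range_eisSum] at hf
    obtain ⟨c, rfl⟩ := hf
    let d : Lam N → ℂ := (2⁻¹ : ℂ) • (c + (-1 : ℂ) ^ k • fun l => c (Lam.act negId l))
    have hd : eisSum k N d = eisSum k N c := by
      simp only [d, map_smul, map_add, eisSum_comp_neg, smul_smul, neg_one_pow_mul_self, one_smul]
      rw [← two_smul ℂ, smul_smul]
      norm_num
    have hpar : ∀ l, d (Lam.act negId l) = (-1) ^ k * d l := by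
      intro l
      simp only [d, Pi.smul_apply, Pi.add_apply, Lam.act_negId_act_negId, smul_eq_mul]
      linear_combination -2⁻¹ * c (Lam.act negId l) * neg_one_pow_mul_self k
    refine ⟨d, ⟨fun γ hγ l => ?_, hpar⟩, hd⟩
    have h := hinv γ⁻¹ (inv_mem hγ)
    rw [← hd, slashf_eisSum, inv_inv] at h
    have h0 : (fun l => d (Lam.act γ l)) - d = 0 := by
      refine eq_zero_of_eisSum_eq_zero hk (fun l => ?_) (by rw [map_sub, h, sub_self])
      simp only [Pi.sub_apply, Lam.act_negId_comm, hpar, mul_sub]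
    exact sub_eq_zero.mp (congrFun h0 l)

lemma finrank_eisSpace (hk : 3 ≤ k) :
    Module.finrank ℂ (EisSpace k N G) = Module.finrank ℂ (coeffSpace k N G) := by
  rw [← map_eisSum_coeffSpace hk, ← LinearMap.range_domRestrict]
  refine LinearMap.finrank_range_of_inj ?_
  rw [injective_iff_map_eq_zero]
  rintro ⟨c, hc⟩ h
  exact Subtype.ext (eq_zero_of_eisSum_eq_zero hk hc.2 h)

lemma finrank_coeffSpace_of_even (hk : Even k) :
    Module.finrank ℂ (coeffSpace k N G) =
      Nat.card {O : Set (ZMod N × ZMod N) // isOrbit N (G ⊔ Subgroup.closure {negId}) O} := by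
  set H := G ⊔ Subgroup.closure {negId} with hH
  have hGH : G ≤ H := le_sup_left
  have hneg : negId ∈ H :=
    (le_sup_right : _ ≤ H) (Subgroup.subset_closure (Set.mem_singleton _))
  have : coeffSpace k N G = LinearMap.range (LinearMap.funLeft ℂ ℂ (orbitOf H : Lam N → _)) := by
    ext c
    constructor
    · intro hc
      have hle : H ≤ coeffStabilizer c := by
        refine sup_le (fun γ hγ => hc.1 γ hγ) ((Subgroup.closure_le _).mpr ?_)
        rintro _ rfl l
        rw [hc.2, hk.neg_one_pow, one_mul]
      obtain ⟨g, hg⟩ := exists_comp_orbitOf hle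
      exact ⟨g, funext hg⟩
    · rintro ⟨g, rfl⟩
      refine ⟨fun γ hγ l => ?_, fun l => ?_⟩
      · simp only [LinearMap.funLeft_apply]
        rw [orbitOf_eq_iff.mpr (⟨γ, hGH hγ, rfl⟩ : ∃ δ ∈ H, Lam.act δ l = Lam.act γ l)]
      · simp only [LinearMap.funLeft_apply]
        rw [hk.neg_one_pow, one_mul,
          orbitOf_eq_iff.mpr (⟨negId, hneg, rfl⟩ : ∃ δ ∈ H, Lam.act δ l = Lam.act negId l)]
  rw [this, LinearMap.finrank_range_of_inj
    (LinearMap.funLeft_injective_of_surjective ℂ ℂ _ orbitOf_surjective)]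
  have := Fintype.ofFinite {O : Set (ZMod N × ZMod N) // isOrbit N H O}
  rw [Module.finrank_pi, Nat.card_eq_fintype_card]

lemma two_mul_finrank_coeffSpace_of_odd (hk : Odd k) :
    2 * Module.finrank ℂ (coeffSpace k N G) =
      Nat.card {O : Set (ZMod N × ZMod N) //
        isOrbit N G O ∧ O ∩ ((fun μ : ZMod N × ZMod N => -μ) '' O) = ∅} := by
  let Q := LinearMap.funLeft ℂ ℂ (orbitOf G : Lam N → _)
  have hQ : Function.Injective Q :=
    LinearMap.funLeft_injective_of_surjective ℂ ℂ _ orbitOf_surjective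
  let W := (coeffSpace k N G).comap Q
  have hmap : W.map Q = coeffSpace k N G := by
    refine Submodule.map_comap_eq_of_le fun c hc => ?_
    obtain ⟨g, hg⟩ := exists_comp_orbitOf (c := c) fun γ hγ => hc.1 γ hγ
    exact ⟨g, funext hg⟩
  have hW : ∀ g, g ∈ W ↔ ∀ O, g (negOrbit O) = -g O := by
    intro g
    constructor
    · rintro ⟨-, h⟩ O
      obtain ⟨l, rfl⟩ := orbitOf_surjective O
      have := h l
      rw [hk.neg_one_pow, neg_one_mul] at this
      rw [← orbitOf_act_negId]
      exact this
    · refine fun h => ⟨fun γ hγ l => congrArg g ?_, fun l => ?_⟩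
      · exact (orbitOf_eq_iff.mpr ⟨γ, hγ, rfl⟩).symm
      · rw [hk.neg_one_pow, neg_one_mul]
        change g (orbitOf G (Lam.act negId l)) = _
        rw [orbitOf_act_negId, h]
        rfl
  rw [← hmap, ← (Submodule.equivMapOfInjective Q hQ W).finrank_eq,
    two_mul_finrank_odd negOrbit_involutive W hW]
  exact Nat.card_congr ((Equiv.subtypeEquivRight negOrbit_ne_iff).trans
    (Equiv.subtypeSubtypeEquivSubtypeInter (isOrbit N G)
      fun O => O ∩ ((fun μ : ZMod N × ZMod N => -μ) '' O) = ∅))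

end Dimension

/-- Dimension of the space of weight-`k` (`k ≥ 3`) Eisenstein series on
a congruence subgroup `G ⊇ Γ(N)`: for even `k` it is the number of `G^±`-orbits in
`Λ_N`; for odd `k` with `-Id ∉ G` it is half the number of regular `G`-orbits; for odd
`k` with `-Id ∈ G` the space is zero. -/
theorem dim_eisSpace (k N : ℕ) (hk : 3 ≤ k) [NeZero N]
    (G : Subgroup SL2Z) (hG : CongruenceSubgroup.Gamma N ≤ G) :
    (Even k →
      Module.finrank ℂ (EisSpace k N G) =
        Nat.card {O : Set (ZMod N × ZMod N) //
          isOrbit N (G ⊔ Subgroup.closure {negId}) O}) ∧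
    (Odd k → negId ∉ G →
      2 * Module.finrank ℂ (EisSpace k N G) =
        Nat.card {O : Set (ZMod N × ZMod N) //
          isOrbit N G O ∧ O ∩ ((fun μ : ZMod N × ZMod N => -μ) '' O) = ∅}) ∧
    (Odd k → negId ∈ G → EisSpace k N G = ⊥) := by
  refine ⟨fun h => ?_, fun h _ => ?_, fun h hneg => ?_⟩
  · rw [finrank_eisSpace hk, finrank_coeffSpace_of_even h]
  · rw [finrank_eisSpace hk, two_mul_finrank_coeffSpace_of_odd h]
  · rw [← map_eisSum_coeffSpace hk, coeffSpace_eq_bot_of_odd h hneg, Submodule.map_bot]
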